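/- Let A = (a_{ij}) be an n×n matrix over a commutative integral domain. Let I, J ⊂ {1,…,n} with |I| = |J|, and decompositions J = J_1 ⊔ J_2, I = I_1 ⊔ I_2 with |I_1| = |J_1|. For S ⊆ J_2, there are signs ε(T,S) = ±1 such that M_{I_1}^{J_1} · M_I^J = Σ_{T ⊆ I_2, |T| = |S|} ε(T,S) · M_{I_1 ⊔ T}^{J_1 ⊔ S} · M_{I \ T}^{J \ S}, where M_Y^X denotes the minor of A with columns X and rows Y (both ordered increasingly). -/

import Mathlib

/-- The minor of `A` with rows `I` and columns `J` (each taken in increasing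
order); zero if `|I| ≠ |J|`. -/
noncomputable def minor {n : ℕ} {R : Type*} [CommRing R]
    (A : Matrix (Fin n) (Fin n) R) (I J : Finset (Fin n)) : R :=
  if h : I.card = J.card then
    Matrix.det (Matrix.of fun p q : Fin I.card =>
      A ((I.orderIsoOfFin rfl p : Fin n)) ((J.orderIsoOfFin h.symm q : Fin n)))
  else 0

lemma det_submatrix_pm {R m m' : Type*} [CommRing R] [Fintype m] [DecidableEq m] [Fintype m']
    [DecidableEq m'] (M : Matrix m m R) (e f : m' ≃ m) :
    (M.submatrix e f).det = M.det ∨ (M.submatrix e f).det = -M.det := by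
  have h : M.submatrix e f = (M.submatrix id (e.symm.trans f)).submatrix e e := by
    ext i j; simp
  rw [h, Matrix.det_submatrix_equiv_self, Matrix.det_permute']
  rcases Int.units_eq_one_or (Equiv.Perm.sign (e.symm.trans f)) with h | h <;> rw [h] <;> simp

lemma exists_equiv_of_image {n : ℕ} {m : Type*} [Fintype m] (r : m → Fin n)
    (hr : Function.Injective r) (I : Finset (Fin n)) (hI : Finset.univ.image r = I)
    {k : ℕ} (hk : I.card = k) :
    ∃ e : Fin k ≃ m, ∀ p, r (e p) = (I.orderIsoOfFin hk p : Fin n) := by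
  have h : ∀ p : Fin k, ∃ x, r x = (I.orderIsoOfFin hk p : Fin n) := by
    intro p
    have := (I.orderIsoOfFin hk p).2
    rw [Finset.ext_iff] at hI
    simpa using (hI _).2 this
  choose e he using h
  have hinj : Function.Injective e := by
    intro p q hpq
    apply (I.orderIsoOfFin hk).injective
    apply Subtype.ext
    rw [← he, ← he, hpq]
  have hcard : Fintype.card (Fin k) = Fintype.card m := by
    rw [Fintype.card_fin, ← hk, ← hI, Finset.card_image_of_injective _ hr, Finset.card_univ]
  exact ⟨Equiv.ofBijective e ((Fintype.bijective_iff_injective_and_card e).2 ⟨hinj, hcard⟩), he⟩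

lemma det_eq_minor {n : ℕ} {R m : Type*} [CommRing R] [Fintype m] [DecidableEq m]
    (A : Matrix (Fin n) (Fin n) R) (r c : m → Fin n) (hr : Function.Injective r)
    (hc : Function.Injective c) (I J : Finset (Fin n)) (hI : Finset.univ.image r = I)
    (hJ : Finset.univ.image c = J) :
    (A.submatrix r c).det = minor A I J ∨ (A.submatrix r c).det = -minor A I J := by
  have hcard : I.card = J.card := by
    rw [← hI, ← hJ, Finset.card_image_of_injective _ hr, Finset.card_image_of_injective _ hc]
  obtain ⟨e, he⟩ := exists_equiv_of_image r hr I hI rfl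
  obtain ⟨f, hf⟩ := exists_equiv_of_image c hc J hJ hcard.symm
  have h : minor A I J = ((A.submatrix r c).submatrix e f).det := by
    rw [minor, dif_pos hcard]
    congr 1
    ext p q
    simp [he, hf]
  rw [h]
  rcases det_submatrix_pm (A.submatrix r c) e f with h | h <;> rw [h] <;> simp

/-- Rows in `T` keep only columns in `P`, the other rows keep only the other columns. -/
def maskMat {R ι : Type*} [CommRing R] [DecidableEq ι] (M : Matrix ι ι R)
    (T P : Finset ι) : Matrix ι ι R :=
  Matrix.of fun i j => if (i ∈ T ↔ j ∈ P) then M i j else 0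

lemma det_eq_sum_mask {R ι : Type*} [CommRing R] [Fintype ι] [DecidableEq ι]
    (M : Matrix ι ι R) (P : Finset ι) :
    M.det = ∑ T : Finset ι, (maskMat M T P).det := by
  have h := (Matrix.detRowAlternating (n := ι) (R := R)).toMultilinearMap.map_add_univ
    (fun i j => if j ∈ P then M i j else 0) (fun i j => if j ∈ P then 0 else M i j)
  have h1 : ((fun i j => if j ∈ P then M i j else 0) + (fun i j => if j ∈ P then 0 else M i j)
      : ι → ι → R) = M := by
    ext i j
    by_cases hj : j ∈ P <;> simp [hj]
  rw [h1] at h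
  refine h.trans (Finset.sum_congr rfl fun T _ => ?_)
  change Matrix.det _ = _
  congr 1
  ext i j
  by_cases hi : i ∈ T <;> by_cases hj : j ∈ P <;> simp [maskMat, hi, hj]

lemma mask_det_zero {R ι : Type*} [CommRing R] [Fintype ι] [DecidableEq ι]
    (M : Matrix ι ι R) (T P : Finset ι) (h : T.card ≠ P.card) : (maskMat M T P).det = 0 := by
  rw [← Matrix.det_transpose, Matrix.det_apply]
  refine Finset.sum_eq_zero fun σ _ => ?_
  by_cases hσ : ∀ i, (i ∈ T ↔ σ i ∈ P)
  · exfalso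
    apply h
    exact Finset.card_bij (fun i _ => σ i) (fun i hi => (hσ i).1 hi)
      (fun _ _ _ _ h => σ.injective h)
      (fun j hj => ⟨σ.symm j, (hσ _).2 (by simpa using hj), by simp⟩)
  · push Not at hσ
    obtain ⟨i, hi⟩ := hσ
    rw [Finset.prod_eq_zero (Finset.mem_univ i), smul_zero]
    simp only [Matrix.transpose_apply, maskMat, Matrix.of_apply]
    rw [if_neg]
    tauto

lemma mask_det_eq {n : ℕ} {R ι : Type*} [CommRing R] [Fintype ι] [DecidableEq ι]
    (A : Matrix (Fin n) (Fin n) R) (M : Matrix ι ι R) (r c : ι → Fin n)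
    (T P : Finset ι) (h : T.card = P.card)
    (hM1 : ∀ i ∈ T, ∀ j ∈ P, M i j = A (r i) (c j))
    (hM2 : ∀ i ∉ T, ∀ j ∉ P, M i j = A (r i) (c j))
    (hr1 : ∀ i ∈ T, ∀ j ∈ T, r i = r j → i = j) (hr2 : ∀ i ∉ T, ∀ j ∉ T, r i = r j → i = j)
    (hc1 : ∀ i ∈ P, ∀ j ∈ P, c i = c j → i = j) (hc2 : ∀ i ∉ P, ∀ j ∉ P, c i = c j → i = j) :
    (maskMat M T P).det =
      minor A (T.image r) (P.image c) * minor A (Tᶜ.image r) (Pᶜ.image c) ∨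
    (maskMat M T P).det =
      -(minor A (T.image r) (P.image c) * minor A (Tᶜ.image r) (Pᶜ.image c)) := by
  obtain ⟨e⟩ : Nonempty ({i // i ∈ T} ≃ {j // j ∈ P}) := by
    rw [← Fintype.card_eq]; simpa using h
  let σ : Equiv.Perm ι := e.extendSubtype
  have hσ1 : ∀ i, i ∈ T → σ i ∈ P := fun i hi => e.extendSubtype_mem i hi
  have hσ2 : ∀ i, i ∉ T → σ i ∉ P := fun i hi => e.extendSubtype_not_mem i hi
  have key := Matrix.twoBlockTriangular_det ((maskMat M T P).submatrix id σ) (fun i => i ∈ T)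
    (by
      intro i hi j hj
      simp [maskMat, hi, hσ1 j hj])
  have e1 : ((maskMat M T P).submatrix id σ).toSquareBlockProp (fun i => i ∈ T) =
      A.submatrix (fun i : {i // i ∈ T} => r i) (fun j : {i // i ∈ T} => c (σ j)) := by
    ext ⟨i, hi⟩ ⟨j, hj⟩
    simp [maskMat, Matrix.toSquareBlockProp, hi, hσ1 j hj, hM1 i hi _ (hσ1 j hj)]
  have e2 : ((maskMat M T P).submatrix id σ).toSquareBlockProp (fun i => ¬ i ∈ T) =
      A.submatrix (fun i : {i // ¬ i ∈ T} => r i) (fun j : {i // ¬ i ∈ T} => c (σ j)) := by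
    ext ⟨i, hi⟩ ⟨j, hj⟩
    simp [maskMat, Matrix.toSquareBlockProp, hi, hσ2 j hj, hM2 i hi _ (hσ2 j hj)]
  have d1 := det_eq_minor A (fun i : {i // i ∈ T} => r i) (fun j : {i // i ∈ T} => c (σ j))
    (fun i j hij => Subtype.ext (hr1 _ i.2 _ j.2 hij))
    (fun i j hij => Subtype.ext (σ.injective (hc1 _ (hσ1 _ i.2) _ (hσ1 _ j.2) hij)))
    (T.image r) (P.image c) (by ext x; simp)
    (by
      ext x
      simp only [Finset.mem_image, Finset.mem_univ, true_and, Subtype.exists]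
      constructor
      · rintro ⟨i, hi, rfl⟩; exact ⟨_, hσ1 i hi, rfl⟩
      · rintro ⟨j, hj, rfl⟩
        refine ⟨σ.symm j, ?_, by simp⟩
        by_contra hc
        exact hσ2 _ hc (by simpa using hj))
  have d2 := det_eq_minor A (fun i : {i // ¬ i ∈ T} => r i) (fun j : {i // ¬ i ∈ T} => c (σ j))
    (fun i j hij => Subtype.ext (hr2 _ i.2 _ j.2 hij))
    (fun i j hij => Subtype.ext (σ.injective (hc2 _ (hσ2 _ i.2) _ (hσ2 _ j.2) hij)))
    (Tᶜ.image r) (Pᶜ.image c) (by ext x; simp)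
    (by
      ext x
      simp only [Finset.mem_image, Finset.mem_univ, true_and, Subtype.exists, Finset.mem_compl]
      constructor
      · rintro ⟨i, hi, rfl⟩; exact ⟨_, hσ2 i hi, rfl⟩
      · rintro ⟨j, hj, rfl⟩
        refine ⟨σ.symm j, ?_, by simp⟩
        intro hc
        exact hj (by simpa using hσ1 _ hc))
  rw [e1, e2] at key
  have key2 : ((maskMat M T P).submatrix id σ).det =
      (A.submatrix (fun i : {i // i ∈ T} => r i) (fun j : {i // i ∈ T} => c (σ j))).det *
      (A.submatrix (fun i : {i // ¬ i ∈ T} => r i) (fun j : {i // ¬ i ∈ T} => c (σ j))).det := by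
    convert key
  have hs := det_submatrix_pm (maskMat M T P) (Equiv.refl ι) σ
  rw [Equiv.coe_refl, key2] at hs
  rcases d1 with d1 | d1 <;> rcases d2 with d2 | d2 <;> rw [d1, d2] at hs <;>
    rcases hs with hs | hs <;>
    first
    | (left; linear_combination -hs)
    | (right; linear_combination -hs)
    | (left; linear_combination hs)
    | (right; linear_combination hs)

lemma big_det {R α β : Type*} [CommRing R] [Fintype α] [Fintype β] [DecidableEq α]
    [DecidableEq β] (X : Matrix α α R) (Y : Matrix α β R) (Z : Matrix β α R) (W : Matrix β β R)
    (Q : Matrix β α R) (h1 : Y * Q = 0) (h2 : W * Q = Z) :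
    (Matrix.fromBlocks X Y Z W).det = X.det * W.det := by
  have h : Matrix.fromBlocks X Y Z W * Matrix.fromBlocks 1 0 (-Q) 1 =
      Matrix.fromBlocks X Y 0 W := by
    rw [Matrix.fromBlocks_multiply]
    simp [h1, h2]
  have := congrArg Matrix.det h
  rwa [Matrix.det_mul, Matrix.det_fromBlocks_zero₁₂, Matrix.det_fromBlocks_zero₂₁,
    Matrix.det_one, Matrix.det_one, mul_one, mul_one] at this

/-- Lemma 3.2(1): the generalized Plücker/Sylvester determinantal identity
`M_{I_1}^{J_1} · M_I^J = Σ_{T ⊆ I_2, |T| = |S|} ε(T,S) · M_{I_1⊔T}^{J_1⊔S} ·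
M_{I\T}^{J\S}` with signs `ε(T,S) = ±1`, for `I = I_1 ⊔ I_2`, `J = J_1 ⊔ J_2`,
`|I| = |J|`, `|I_1| = |J_1|`, `S ⊆ J_2`. -/
theorem minor_decomposition (n : ℕ) (R : Type*) [CommRing R] [IsDomain R]
    (A : Matrix (Fin n) (Fin n) R) (I1 I2 J1 J2 S : Finset (Fin n))
    (hI : Disjoint I1 I2) (hJ : Disjoint J1 J2)
    (hcard : (I1 ∪ I2).card = (J1 ∪ J2).card) (hcard1 : I1.card = J1.card)
    (hS : S ⊆ J2) :
    ∃ ε : Finset (Fin n) → R, (∀ T, ε T = 1 ∨ ε T = -1) ∧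
      minor A I1 J1 * minor A (I1 ∪ I2) (J1 ∪ J2) =
        ∑ T ∈ Finset.powersetCard S.card I2,
          ε T * minor A (I1 ∪ T) (J1 ∪ S) *
            minor A ((I1 ∪ I2) \ T) ((J1 ∪ J2) \ S) := by
  classical
  suffices hmain : ∃ δ : Finset (Fin n) → R, (∀ T, δ T = 1 ∨ δ T = -1) ∧
      (minor A I1 J1 * minor A (I1 ∪ I2) (J1 ∪ J2) =
        ∑ T ∈ Finset.powersetCard S.card I2,
          δ T * minor A (I1 ∪ T) (J1 ∪ S) * minor A ((I1 ∪ I2) \ T) ((J1 ∪ J2) \ S) ∨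
      minor A I1 J1 * minor A (I1 ∪ I2) (J1 ∪ J2) =
        -∑ T ∈ Finset.powersetCard S.card I2,
          δ T * minor A (I1 ∪ T) (J1 ∪ S) * minor A ((I1 ∪ I2) \ T) ((J1 ∪ J2) \ S)) by
    obtain ⟨δ, hδ, h | h⟩ := hmain
    · exact ⟨δ, hδ, h⟩
    · refine ⟨fun T => -δ T, fun T => ?_, ?_⟩
      · rcases hδ T with h | h <;> simp [h]
      · rw [h, ← Finset.sum_neg_distrib]
        exact Finset.sum_congr rfl fun T _ => by ring
  set I := I1 ∪ I2 with hIdef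
  set J := J1 ∪ J2 with hJdef
  obtain ⟨e1⟩ : Nonempty ({i // i ∈ I1} ≃ {j // j ∈ J1}) := by
    rw [← Fintype.card_eq]; simpa using hcard1
  obtain ⟨e2⟩ : Nonempty ({i // i ∈ I} ≃ {j // j ∈ J}) := by
    rw [← Fintype.card_eq]; simpa using hcard
  let r : {i // i ∈ I1} ⊕ {i // i ∈ I} → Fin n := Sum.elim (fun i => i) (fun i => i)
  let c : {i // i ∈ I1} ⊕ {i // i ∈ I} → Fin n := Sum.elim (fun i => e1 i) (fun i => e2 i)
  let P : Finset ({i // i ∈ I1} ⊕ {i // i ∈ I}) :=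
    Finset.univ.filter (fun x => Sum.elim (fun _ => True) (fun k => (e2 k : Fin n) ∈ S) x)
  let φ : Finset (Fin n) → Finset ({i // i ∈ I1} ⊕ {i // i ∈ I}) := fun T =>
    Finset.univ.filter (fun x => Sum.elim (fun _ => True) (fun k : {i // i ∈ I} => k.1 ∈ T) x)
  let X : Matrix {i // i ∈ I1} {i // i ∈ I1} R := A.submatrix (fun i => i) (fun i => e1 i)
  let W : Matrix {i // i ∈ I} {i // i ∈ I} R := A.submatrix (fun i => i) (fun i => e2 i)
  let Z : Matrix {i // i ∈ I} {i // i ∈ I1} R := A.submatrix (fun i => i) (fun i => e1 i)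
  let Y : Matrix {i // i ∈ I1} {i // i ∈ I} R :=
    Matrix.of fun i k => if (e2 k : Fin n) ∈ S then A i (e2 k) else 0
  let Q : Matrix {i // i ∈ I} {i // i ∈ I1} R :=
    Matrix.of fun k i => if (e2 k : Fin n) = e1 i then 1 else 0
  let B := Matrix.fromBlocks X Y Z W
  have hSJ1 : ∀ x ∈ S, x ∉ J1 := fun x hx hx1 => Finset.disjoint_left.1 hJ hx1 (hS hx)
  have hYQ : Y * Q = 0 := by
    ext i j
    rw [Matrix.mul_apply]
    refine Finset.sum_eq_zero fun k _ => ?_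
    by_cases hk : (e2 k : Fin n) = e1 j
    · have : (e2 k : Fin n) ∉ S := fun h => hSJ1 _ h (hk ▸ (e1 j).2)
      simp [Y, this]
    · simp [Q, hk]
  have hWQ : W * Q = Z := by
    ext i j
    rw [Matrix.mul_apply]
    have hj : (e1 j : Fin n) ∈ J := Finset.mem_union_left _ (e1 j).2
    rw [Finset.sum_eq_single (e2.symm ⟨e1 j, hj⟩)]
    · simp [W, Q, Z]
    · intro k _ hk
      have : (e2 k : Fin n) ≠ e1 j := by
        intro h
        apply hk
        rw [Equiv.eq_symm_apply]
        exact Subtype.ext h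
      simp [Q, this]
    · simp
  have hB : B.det = X.det * W.det := big_det X Y Z W Q hYQ hWQ
  have hX := det_eq_minor A (fun i : {i // i ∈ I1} => (i : Fin n)) (fun i => (e1 i : Fin n))
    Subtype.val_injective (Subtype.val_injective.comp e1.injective) I1 J1 (by ext x; simp)
    (by
      ext x
      simp only [Finset.mem_image, Finset.mem_univ, true_and]
      exact ⟨by rintro ⟨i, rfl⟩; exact (e1 i).2, fun hx => ⟨e1.symm ⟨x, hx⟩, by simp⟩⟩)
  have hW := det_eq_minor A (fun i : {i // i ∈ I} => (i : Fin n)) (fun i => (e2 i : Fin n))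
    Subtype.val_injective (Subtype.val_injective.comp e2.injective) I J (by ext x; simp)
    (by
      ext x
      simp only [Finset.mem_image, Finset.mem_univ, true_and]
      exact ⟨by rintro ⟨i, rfl⟩; exact (e2 i).2, fun hx => ⟨e2.symm ⟨x, hx⟩, by simp⟩⟩)
  have hBm : minor A I1 J1 * minor A I J = B.det ∨ minor A I1 J1 * minor A I J = -B.det := by
    rw [hB]
    change X.det = _ ∨ X.det = _ at hX
    change W.det = _ ∨ W.det = _ at hW
    rcases hX with h | h <;> rcases hW with h' | h' <;> rw [h, h'] <;> simp
  -- column facts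
  have hc1 : ∀ i ∈ P, ∀ j ∈ P, c i = c j → i = j := by
    rintro (i | i) hi (j | j) hj hij
    · have : e1 i = e1 j := Subtype.ext hij
      rw [e1.injective this]
    · exfalso
      simp [P] at hj
      simp [c] at hij
      exact hSJ1 _ hj (hij ▸ (e1 i).2)
    · exfalso
      simp [P] at hi
      simp [c] at hij
      exact hSJ1 _ hi (hij ▸ (e1 j).2)
    · have : e2 i = e2 j := Subtype.ext hij
      rw [e2.injective this]
  have hc2 : ∀ i ∉ P, ∀ j ∉ P, c i = c j → i = j := by
    rintro (i | i) hi (j | j) hj hij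
    · simp [P] at hi
    · simp [P] at hi
    · simp [P] at hj
    · have : e2 i = e2 j := Subtype.ext hij
      rw [e2.injective this]
  have hSJ : ∀ x ∈ S, x ∈ J := fun x hx => Finset.mem_union_right _ (hS hx)
  have hPc : P.image c = J1 ∪ S := by
    ext x
    simp only [Finset.mem_image, Finset.mem_union]
    constructor
    · rintro ⟨i | i, hi, rfl⟩
      · exact Or.inl (e1 i).2
      · simp [P] at hi; exact Or.inr hi
    · rintro (hx | hx)
      · exact ⟨Sum.inl (e1.symm ⟨x, hx⟩), by simp [P], by simp [c]⟩
      · exact ⟨Sum.inr (e2.symm ⟨x, hSJ x hx⟩), by simp [P, hx], by simp [c]⟩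
  have hPc' : Pᶜ.image c = J \ S := by
    ext x
    simp only [Finset.mem_image, Finset.mem_sdiff, Finset.mem_compl]
    constructor
    · rintro ⟨i | i, hi, rfl⟩
      · simp [P] at hi
      · simp [P] at hi; exact ⟨(e2 i).2, hi⟩
    · rintro ⟨hx, hx'⟩
      exact ⟨Sum.inr (e2.symm ⟨x, hx⟩), by simp [P, hx'], by simp [c]⟩
  have hPcard : P.card = J1.card + S.card := by
    rw [← Finset.card_image_of_injOn (f := c) (s := P) (fun i hi j hj h => hc1 i hi j hj h), hPc,
      Finset.card_union_of_disjoint]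
    exact Finset.disjoint_left.2 fun x h1 h2 => hSJ1 x h2 h1
  -- row facts
  have hr1 : ∀ T ⊆ I2, ∀ i ∈ φ T, ∀ j ∈ φ T, r i = r j → i = j := by
    rintro T hT (i | i) hi (j | j) hj hij
    · rw [Subtype.ext (hij : (i : Fin n) = j)]
    · exfalso
      simp [φ] at hj
      simp [r] at hij
      exact Finset.disjoint_left.1 hI i.2 (hij ▸ hT hj)
    · exfalso
      simp [φ] at hi
      simp [r] at hij
      exact Finset.disjoint_left.1 hI j.2 (hij ▸ hT hi)
    · rw [Subtype.ext (hij : (i : Fin n) = j)]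
  have hr2 : ∀ T ⊆ I2, ∀ i ∉ φ T, ∀ j ∉ φ T, r i = r j → i = j := by
    rintro T hT (i | i) hi (j | j) hj hij
    · simp [φ] at hi
    · simp [φ] at hi
    · simp [φ] at hj
    · rw [Subtype.ext (hij : (i : Fin n) = j)]
  have hφr : ∀ T ⊆ I2, (φ T).image r = I1 ∪ T := by
    intro T hT
    ext x
    simp only [Finset.mem_image, Finset.mem_union]
    constructor
    · rintro ⟨i | i, hi, rfl⟩
      · exact Or.inl i.2
      · simp [φ] at hi; exact Or.inr hi
    · rintro (hx | hx)
      · exact ⟨Sum.inl ⟨x, hx⟩, by simp [φ], by simp [r]⟩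
      · exact ⟨Sum.inr ⟨x, Finset.mem_union_right _ (hT hx)⟩, by simp [φ, hx], by simp [r]⟩
  have hφr' : ∀ T ⊆ I2, (φ T)ᶜ.image r = I \ T := by
    intro T hT
    ext x
    simp only [Finset.mem_image, Finset.mem_sdiff, Finset.mem_compl]
    constructor
    · rintro ⟨i | i, hi, rfl⟩
      · simp [φ] at hi
      · simp [φ] at hi; exact ⟨i.2, hi⟩
    · rintro ⟨hx, hx'⟩
      exact ⟨Sum.inr ⟨x, hx⟩, by simp [φ, hx'], by simp [r]⟩
  have hφcard : ∀ T ⊆ I2, (φ T).card = I1.card + T.card := by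
    intro T hT
    rw [← Finset.card_image_of_injOn (f := r) (s := φ T)
      (fun i hi j hj h => hr1 T hT i hi j hj h), hφr T hT, Finset.card_union_of_disjoint]
    exact Finset.disjoint_left.2 fun x h1 h2 => Finset.disjoint_left.1 hI h1 (hT h2)
  have hterm : ∀ T ∈ Finset.powersetCard S.card I2, (maskMat B (φ T) P).det =
      minor A (I1 ∪ T) (J1 ∪ S) * minor A (I \ T) (J \ S) ∨ (maskMat B (φ T) P).det =
      -(minor A (I1 ∪ T) (J1 ∪ S) * minor A (I \ T) (J \ S)) := by
    intro T hT
    obtain ⟨hT, hTc⟩ := Finset.mem_powersetCard.1 hT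
    rw [← hPc, ← hPc', ← hφr T hT, ← hφr' T hT]
    refine mask_det_eq A B r c (φ T) P ?_ ?_ ?_ (hr1 T hT) (hr2 T hT) hc1 hc2
    · rw [hφcard T hT, hPcard, hTc, hcard1]
    · rintro (i | i) hi (j | j) hj
      · rfl
      · simp [P] at hj
        simp [B, Y, hj, r, c]
      · rfl
      · rfl
    · rintro (i | i) hi (j | j) hj
      · rfl
      · simp [φ] at hi
      · rfl
      · rfl
  have hsum : B.det = ∑ T ∈ Finset.powersetCard S.card I2, (maskMat B (φ T) P).det := by
    rw [det_eq_sum_mask B P]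
    symm
    refine Finset.sum_of_injOn φ ?_ (fun _ _ => Finset.mem_coe.2 (Finset.mem_univ _)) ?_
      (fun _ _ => rfl)
    · intro T hT T' hT' h
      have hT := (Finset.mem_powersetCard.1 (Finset.mem_coe.1 hT)).1
      have hT' := (Finset.mem_powersetCard.1 (Finset.mem_coe.1 hT')).1
      ext x
      constructor
      · intro hx
        have : Sum.inr ⟨x, Finset.mem_union_right _ (hT hx)⟩ ∈ φ T := by simp [φ, hx]
        rw [h] at this
        simpa [φ] using this
      · intro hx
        have : Sum.inr ⟨x, Finset.mem_union_right _ (hT' hx)⟩ ∈ φ T' := by simp [φ, hx]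
        rw [← h] at this
        simpa [φ] using this
    · intro U _ hU
      by_cases hcd : U.card = P.card
      swap
      · exact mask_det_zero B U P hcd
      by_cases hl : ∃ i, Sum.inl i ∉ U
      · obtain ⟨i, hi⟩ := hl
        refine Matrix.det_eq_zero_of_row_eq_zero (Sum.inl i) ?_
        rintro (j | j)
        · simp [maskMat, hi, P]
        · by_cases hj : (e2 j : Fin n) ∈ S
          · simp [maskMat, hi, P, hj]
          · simp [maskMat, hi, P, hj, B, Y]
      push Not at hl
      by_cases hd : ∃ i : {i // i ∈ I}, (i : Fin n) ∈ I1 ∧ Sum.inr i ∈ U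
      · obtain ⟨i, hi1, hi⟩ := hd
        refine Matrix.det_zero_of_row_eq (i := Sum.inl ⟨i, hi1⟩) (j := Sum.inr i)
          (by simp) ?_
        funext j
        rcases j with j | j
        · simp [maskMat, hi, hl, P, B, X, Z]
        · by_cases hj : (e2 j : Fin n) ∈ S <;> simp [maskMat, hi, hl, P, B, Y, W, hj]
      push Not at hd
      exfalso
      apply hU
      let T : Finset (Fin n) := I.filter (fun x => ∃ h : x ∈ I, Sum.inr ⟨x, h⟩ ∈ U)
      have hT : T ⊆ I2 := by
        intro x hx
        obtain ⟨hxI, h, hxU⟩ := Finset.mem_filter.1 hx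
        rcases Finset.mem_union.1 hxI with h1 | h1
        · exact absurd hxU (hd ⟨x, h⟩ h1)
        · exact h1
      have hφT : φ T = U := by
        ext x
        rcases x with x | x
        · simp [φ, hl]
        · simp only [φ, T, Finset.mem_filter, Finset.mem_univ, true_and, Sum.elim_inr]
          exact ⟨fun h => h.2.2, fun h => ⟨x.2, x.2, h⟩⟩
      refine ⟨T, Finset.mem_coe.2 (Finset.mem_powersetCard.2 ⟨hT, ?_⟩), hφT⟩
      have := hφcard T hT
      rw [hφT, hcd, hPcard] at this
      omega
  refine ⟨fun T => if (maskMat B (φ T) P).det =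
      minor A (I1 ∪ T) (J1 ∪ S) * minor A (I \ T) (J \ S) then 1 else -1, fun T => ?_, ?_⟩
  · dsimp only
    split_ifs <;> simp
  · have : B.det = ∑ T ∈ Finset.powersetCard S.card I2, (if (maskMat B (φ T) P).det =
        minor A (I1 ∪ T) (J1 ∪ S) * minor A (I \ T) (J \ S) then (1 : R) else -1) *
        minor A (I1 ∪ T) (J1 ∪ S) * minor A (I \ T) (J \ S) := by
      rw [hsum]
      refine Finset.sum_congr rfl fun T hT => ?_
      split_ifs with h
      · rw [h]; ring
      · rw [(hterm T hT).resolve_left h]; ring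
    rw [← this]
    exact hBm
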